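/- Define H₂ : (ρ₋, ρ₊) → ℝ by H₂(ρ) = [(ρ₊ − ρ)(ρ − ρ₋)/Q₀(ρ)²]·√(ρ₊·ρ₋)·(ρ₊ − ρ₋)·( (3/2)·G₀''(ρ) − ẽ₀''(ρ) ) − [ρ₊·ρ₋·(ρ₊ − ρ₋)²/Q₀(ρ)³]·√ρ₊·(ρ₊ − ρ)·G₀''(ρ). Then there exists ρ̄ ∈ (ρ₋, ρ₊) with H₂(ρ̄) > 0 if and only if √(ρ₊/ρ₋) > (4 + 2·√10)/3. -/

import Mathlib

noncomputable section

/-- `Q₀(ρ) = (ρ − ρ₋)√ρ₋ + (ρ₊ − ρ)√ρ₊`. -/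
def Q0 (ρm ρp ρ : ℝ) : ℝ := (ρ - ρm) * Real.sqrt ρm + (ρp - ρ) * Real.sqrt ρp

/-- `G₀(ρ) = (ρ₊ − ρ)(ρ − ρ₋)(√ρ₋ − √ρ₊)/Q₀(ρ)`. -/
def G0 (ρm ρp ρ : ℝ) : ℝ :=
  (ρp - ρ) * (ρ - ρm) * (Real.sqrt ρm - Real.sqrt ρp) / Q0 ρm ρp ρ

/-- `ẽ₀(ρ) = ρ₊ρ₋(ρ₊ − ρ₋)²/(2 Q₀(ρ)²)`. -/
def e0 (ρm ρp ρ : ℝ) : ℝ := ρp * ρm * (ρp - ρm) ^ 2 / (2 * Q0 ρm ρp ρ ^ 2)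
/-- The function `H₂`. -/
def H2 (ρm ρp ρ : ℝ) : ℝ :=
  ((ρp - ρ) * (ρ - ρm) / Q0 ρm ρp ρ ^ 2) * Real.sqrt (ρp * ρm) * (ρp - ρm) *
      ((3 / 2) * deriv (deriv (G0 ρm ρp)) ρ - deriv (deriv (e0 ρm ρp)) ρ) -
    (ρp * ρm * (ρp - ρm) ^ 2 / Q0 ρm ρp ρ ^ 3) * Real.sqrt ρp * (ρp - ρ) *
      deriv (deriv (G0 ρm ρp)) ρ

theorem Q0_pos {ρm ρp ρ : ℝ} (hρm : 0 < ρm) (h : ρ ∈ Set.Ioo ρm ρp) : 0 < Q0 ρm ρp ρ := by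
  have hm := Real.sqrt_pos.2 hρm
  have hp := Real.sqrt_pos.2 (hρm.trans (h.1.trans h.2))
  exact add_pos (mul_pos (sub_pos.2 h.1) hm) (mul_pos (sub_pos.2 h.2) hp)

theorem hasDerivAt_Q0 (ρm ρp ρ : ℝ) :
    HasDerivAt (Q0 ρm ρp) (Real.sqrt ρm - Real.sqrt ρp) ρ := by
  unfold Q0
  have h := (((hasDerivAt_id ρ).sub_const ρm).mul_const (Real.sqrt ρm)).add
    (((hasDerivAt_id ρ).const_sub ρp).mul_const (Real.sqrt ρp))
  exact h.congr_deriv (by ring)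

theorem hasDerivAt_const_div_Q0_pow {ρm ρp ρ : ℝ} (c : ℝ) (n : ℕ) (hQ : Q0 ρm ρp ρ ≠ 0) :
    HasDerivAt (fun t => c / Q0 ρm ρp t ^ n)
      (n * c * (Real.sqrt ρp - Real.sqrt ρm) / Q0 ρm ρp ρ ^ (n + 1)) ρ := by
  have h := ((hasDerivAt_const ρ c).div ((hasDerivAt_Q0 ρm ρp ρ).pow n) (pow_ne_zero n hQ))
  refine h.congr_deriv ?_
  rcases n with _ | n
  · simp
  · simp only [Nat.add_sub_cancel, Pi.pow_apply]
    field_simp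
    ring

theorem hasDerivAt_G0 {ρm ρp ρ : ℝ} (hm : 0 ≤ ρm) (hp : 0 ≤ ρp) (hQ : Q0 ρm ρp ρ ≠ 0) :
    HasDerivAt (G0 ρm ρp)
      (Real.sqrt ρm * Real.sqrt ρp * (ρp - ρm) ^ 2 / Q0 ρm ρp ρ ^ 2 - 1) ρ := by
  have h := (((((hasDerivAt_id ρ).const_sub ρp).mul ((hasDerivAt_id ρ).sub_const ρm)).mul_const
    (Real.sqrt ρm - Real.sqrt ρp)).div (hasDerivAt_Q0 ρm ρp ρ) hQ)
  refine h.congr_deriv ?_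
  simp only [Pi.mul_apply, id]
  rw [div_sub_one (pow_ne_zero 2 hQ)]
  congr 1
  unfold Q0
  obtain ⟨a, ha, rfl⟩ : ∃ a, 0 ≤ a ∧ a ^ 2 = ρm := ⟨_, Real.sqrt_nonneg _, Real.sq_sqrt hm⟩
  obtain ⟨b, hb, rfl⟩ : ∃ b, 0 ≤ b ∧ b ^ 2 = ρp := ⟨_, Real.sqrt_nonneg _, Real.sq_sqrt hp⟩
  rw [Real.sqrt_sq ha, Real.sqrt_sq hb]
  ring

theorem deriv_deriv_G0 {ρm ρp ρ : ℝ} (hρm : 0 < ρm) (h : ρ ∈ Set.Ioo ρm ρp) :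
    deriv (deriv (G0 ρm ρp)) ρ = 2 * (Real.sqrt ρm * Real.sqrt ρp * (ρp - ρm) ^ 2) *
      (Real.sqrt ρp - Real.sqrt ρm) / Q0 ρm ρp ρ ^ 3 := by
  have hp : 0 < ρp := hρm.trans (h.1.trans h.2)
  have hd : deriv (G0 ρm ρp) =ᶠ[nhds ρ] fun t =>
      Real.sqrt ρm * Real.sqrt ρp * (ρp - ρm) ^ 2 / Q0 ρm ρp t ^ 2 - 1 := by
    filter_upwards [Ioo_mem_nhds h.1 h.2] with t ht
    exact (hasDerivAt_G0 hρm.le hp.le (Q0_pos hρm ht).ne').deriv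
  rw [hd.deriv_eq]
  exact_mod_cast ((hasDerivAt_const_div_Q0_pow _ 2 (Q0_pos hρm h).ne').sub_const 1).deriv

theorem deriv_deriv_e0 {ρm ρp ρ : ℝ} (hρm : 0 < ρm) (h : ρ ∈ Set.Ioo ρm ρp) :
    deriv (deriv (e0 ρm ρp)) ρ = 3 * (ρp * ρm * (ρp - ρm) ^ 2) *
      (Real.sqrt ρp - Real.sqrt ρm) ^ 2 / Q0 ρm ρp ρ ^ 4 := by
  have he : e0 ρm ρp = fun t => ρp * ρm * (ρp - ρm) ^ 2 / 2 / Q0 ρm ρp t ^ 2 := by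
    funext t
    rw [e0, div_div]
  have hd : deriv (e0 ρm ρp) =ᶠ[nhds ρ] fun t =>
      ρp * ρm * (ρp - ρm) ^ 2 * (Real.sqrt ρp - Real.sqrt ρm) / Q0 ρm ρp t ^ 3 := by
    filter_upwards [Ioo_mem_nhds h.1 h.2] with t ht
    rw [he, (hasDerivAt_const_div_Q0_pow _ 2 (Q0_pos hρm ht).ne').deriv]
    push_cast
    ring
  rw [hd.deriv_eq, (hasDerivAt_const_div_Q0_pow _ 3 (Q0_pos hρm h).ne').deriv]
  push_cast
  ring

theorem H2_sq_eq {a b ρ : ℝ} (ha : 0 < a) (hb : 0 < b) (h : ρ ∈ Set.Ioo (a ^ 2) (b ^ 2)) :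
    H2 (a ^ 2) (b ^ 2) ρ =
      a ^ 2 * b ^ 2 * (b ^ 2 - a ^ 2) ^ 3 * (b - a) ^ 2 * (b ^ 2 - ρ) / Q0 (a ^ 2) (b ^ 2) ρ ^ 6 *
        (3 * (ρ - a ^ 2) * (b ^ 2 - (ρ - a ^ 2)) - 2 * a * b ^ 2 * (a + b)) := by
  have hQ := (Q0_pos (pow_pos ha 2) h).ne'
  rw [H2, deriv_deriv_G0 (pow_pos ha 2) h, deriv_deriv_e0 (pow_pos ha 2) h, ← mul_pow,
    Real.sqrt_sq (mul_pos hb ha).le, Real.sqrt_sq ha.le, Real.sqrt_sq hb.le]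
  have hQ0 : Q0 (a ^ 2) (b ^ 2) ρ = (ρ - a ^ 2) * a + (b ^ 2 - ρ) * b := by
    rw [Q0, Real.sqrt_sq ha.le, Real.sqrt_sq hb.le]
  generalize Q0 (a ^ 2) (b ^ 2) ρ = q at hQ hQ0
  field_simp
  rw [hQ0]
  ring

theorem H2_sq_pos_iff {a b ρ : ℝ} (ha : 0 < a) (hab : a < b)
    (h : ρ ∈ Set.Ioo (a ^ 2) (b ^ 2)) :
    0 < H2 (a ^ 2) (b ^ 2) ρ ↔
      2 * a * b ^ 2 * (a + b) < 3 * (ρ - a ^ 2) * (b ^ 2 - (ρ - a ^ 2)) := by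
  have hb := ha.trans hab
  have hQ := Q0_pos (pow_pos ha 2) h
  have h₁ := sub_pos.2 hab
  have h₂ := sub_pos.2 h.2
  have h₃ := sub_pos.2 (h.1.trans h.2)
  rw [H2_sq_eq ha hb h, mul_pos_iff_of_pos_left (by positivity), sub_pos]

theorem lt_div_iff_quadratic {a b : ℝ} (ha : 0 < a) (hb : 0 < b) :
    (4 + 2 * Real.sqrt 10) / 3 < b / a ↔ 8 * a * (a + b) < 3 * b ^ 2 := by
  have hs : Real.sqrt 10 ^ 2 = 10 := Real.sq_sqrt (by norm_num)
  have hs3 : 3 < Real.sqrt 10 := Real.lt_sqrt_of_sq_lt (by norm_num)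
  have hfac : 3 * b ^ 2 - 8 * a * (a + b) =
      (3 * b - (4 + 2 * Real.sqrt 10) * a) * (3 * b + (2 * Real.sqrt 10 - 4) * a) / 3 := by
    linear_combination (4 / 3) * a ^ 2 * hs
  have hpos : 0 < 3 * b + (2 * Real.sqrt 10 - 4) * a := by
    have : 0 < 2 * Real.sqrt 10 - 4 := by linarith
    positivity
  rw [div_lt_div_iff₀ three_pos ha, ← sub_pos (b := 8 * a * (a + b)), hfac, mul_div_assoc,
    mul_pos_iff_of_pos_right (by positivity), sub_pos, mul_comm b]

/-- There exists `ρ̄ ∈ (ρ₋, ρ₊)` with `H₂(ρ̄) > 0` if and only if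
`√(ρ₊/ρ₋) > (4 + 2√10)/3`. -/
theorem H2_positive_iff (ρm ρp : ℝ) (hρm : 0 < ρm) (hρ : ρm < ρp) :
    (∃ ρ ∈ Set.Ioo ρm ρp, 0 < H2 ρm ρp ρ) ↔
      (4 + 2 * Real.sqrt 10) / 3 < Real.sqrt (ρp / ρm) := by
  obtain ⟨a, ha, rfl⟩ : ∃ a, 0 < a ∧ a ^ 2 = ρm :=
    ⟨_, Real.sqrt_pos.2 hρm, Real.sq_sqrt hρm.le⟩
  obtain ⟨b, hb, rfl⟩ : ∃ b, 0 < b ∧ b ^ 2 = ρp :=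
    ⟨_, Real.sqrt_pos.2 (hρm.trans hρ), Real.sq_sqrt (hρm.trans hρ).le⟩
  have hab : a < b := lt_of_pow_lt_pow_left₀ 2 hb.le hρ
  rw [← div_pow, Real.sqrt_sq (by positivity), lt_div_iff_quadratic ha hb]
  constructor
  · rintro ⟨ρ, h, hH⟩
    rw [H2_sq_pos_iff ha hab h] at hH
    have : b ^ 2 * (8 * a * (a + b)) < b ^ 2 * (3 * b ^ 2) := by
      nlinarith [sq_nonneg (b ^ 2 - 2 * (ρ - a ^ 2))]
    exact lt_of_mul_lt_mul_left this (by positivity)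
  · intro hq
    have hmem : a ^ 2 + b ^ 2 / 2 ∈ Set.Ioo (a ^ 2) (b ^ 2) := by
      constructor <;> nlinarith [mul_pos ha (sub_pos.2 hab), pow_pos ha 2, pow_pos hb 2]
    refine ⟨_, hmem, (H2_sq_pos_iff ha hab hmem).2 ?_⟩
    have := mul_lt_mul_of_pos_left hq (pow_pos hb 2)
    linarith
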